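/- Let z₁, z₂, z₃ be three distinct points of ℝ², and suppose φ₁, φ₂, φ₃ and ψ₁, ψ₂, ψ₃ are continuous injective paths [0,1] → ℝ² with φₛ(0) = ψₛ(0) = zₛ, all φₛ ending at a common point z′, all ψₛ ending at a common point z″ ≠ z′, such that the φ-arcs are pairwise disjoint except at z′, the ψ-arcs are pairwise disjoint except at z″, and (⋃ₛ φₛ([0,1])) ∩ (⋃ₛ ψₛ([0,1])) = {z₁, z₂, z₃}. Then the complement ℝ² \ ⋃ₛ (φₛ([0,1]) ∪ ψₛ([0,1])) has exactly three connected components, and the closure of each component contains exactly two of the points z₁, z₂, z₃. -/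

import Mathlib

open Metric Set

/-- The plane `ℝ²`. -/
abbrev Plane := EuclideanSpace ℝ (Fin 2)

section Logarithms

open Complex

/-- `f` has a continuous logarithm on `s`. -/
def HasLogOn (f : ℂ → ℂ) (s : Set ℂ) : Prop :=
  ∃ g : ℂ → ℂ, ContinuousOn g s ∧ ∀ z ∈ s, exp (g z) = f z

/-- A compact set on which every nonvanishing continuous function has a continuous logarithm. -/
structure IsLogTrivial (K : Set ℂ) : Prop where
  isCompact : IsCompact K
  hasLogOn : ∀ f : ℂ → ℂ, ContinuousOn f K → (∀ z ∈ K, f z ≠ 0) → HasLogOn f K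

/-- Homotopy lifting for the exponential. -/
theorem exists_continuous_exp_lift {X : Type*} [TopologicalSpace X] (H : unitInterval × X → ℂ)
    (hH : Continuous H) (hne : ∀ x, H x ≠ 0) (g : X → ℂ) (hg : Continuous g)
    (hg0 : ∀ x, exp (g x) = H (0, x)) :
    ∃ G : unitInterval × X → ℂ, Continuous G ∧ (∀ x, exp (G x) = H x) ∧ ∀ x, G (0, x) = g x := by
  let H' : C(unitInterval × X, {z : ℂ // z ≠ 0}) := ⟨fun x ↦ ⟨H x, hne x⟩, by fun_prop⟩
  have h0 : ∀ x, H' (0, x) = (fun z : ℂ ↦ (⟨_, z.exp_ne_zero⟩ : {z : ℂ // z ≠ 0}))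
      ((⟨g, hg⟩ : C(X, ℂ)) x) := fun x ↦ Subtype.ext (hg0 x).symm
  refine ⟨isCoveringMap_exp.liftHomotopy H' ⟨g, hg⟩ h0, ContinuousMap.continuous _, fun x ↦ ?_,
    isCoveringMap_exp.liftHomotopy_zero H' ⟨g, hg⟩ h0⟩
  exact congrArg Subtype.val (congrFun (isCoveringMap_exp.liftHomotopy_lifts H' ⟨g, hg⟩ h0) x)

/-- Two continuous logarithms of the same function on a preconnected set that agree somewhere
are equal. -/
theorem eqOn_of_exp_eq {X : Type*} [TopologicalSpace X] {s : Set X} (hs : IsPreconnected s)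
    {g h : X → ℂ} (hg : ContinuousOn g s) (hh : ContinuousOn h s)
    (he : ∀ x ∈ s, exp (g x) = exp (h x)) {a : X} (ha : a ∈ s) (hga : g a = h a) :
    EqOn g h s :=
  isCoveringMap_exp.eqOn_of_comp_eqOn hs hg hh (fun x hx ↦ Subtype.ext (he x hx)) ha hga

theorem exists_log_of_continuous {f : ℂ → ℂ} (hf : Continuous f) (hne : ∀ z, f z ≠ 0) :
    ∃ g : ℂ → ℂ, Continuous g ∧ ∀ z, exp (g z) = f z := by
  obtain ⟨G, hG, hGe, -⟩ := exists_continuous_exp_lift (X := ℂ)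
    (fun x ↦ f ((x.1 : ℝ) * x.2)) (by fun_prop) (fun x ↦ hne _) (fun _ ↦ log (f 0))
    continuous_const (fun x ↦ by simp [exp_log (hne 0)])
  exact ⟨fun z ↦ G (1, z), by fun_prop, fun z ↦ by simp [hGe]⟩

/-- A nonzero power does not have a continuous logarithm around a circle. -/
theorem not_exists_log_circle {m : ℤ} (hm : m ≠ 0) {c : ℂ} {G : ℝ → ℂ}
    (hG : Continuous G) (hper : G (2 * Real.pi) = G 0)
    (he : ∀ θ : ℝ, exp (G θ) = c * exp (m * (θ * I))) : False := by
  have hc : exp (G 0) = c := by simpa using he 0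
  have := eqOn_of_exp_eq (X := ℝ) isPreconnected_univ (g := G)
    (h := fun θ ↦ G 0 + m * (θ * I)) hG.continuousOn (by fun_prop)
    (fun θ _ ↦ by rw [he, exp_add, hc]) (mem_univ 0) (by simp)
  have h2 := this (mem_univ (2 * Real.pi))
  rw [hper] at h2
  simp [hm, Real.pi_ne_zero] at h2

theorem exists_continuousOn_union {X Y : Type*} [TopologicalSpace X] [TopologicalSpace Y]
    {s t : Set X} (hst : IsOpen s ∧ IsOpen t ∨ IsClosed s ∧ IsClosed t) {g h : X → Y}
    (hg : ContinuousOn g s) (hh : ContinuousOn h t) (hgh : EqOn g h (s ∩ t)) :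
    ∃ k : X → Y, ContinuousOn k (s ∪ t) ∧ EqOn k g s ∧ EqOn k h t := by
  classical
  have h1 : EqOn (s.piecewise g h) g s := s.piecewise_eqOn g h
  have h2 : EqOn (s.piecewise g h) h t := fun x hx ↦ by
    by_cases hxs : x ∈ s
    · rw [h1 hxs, hgh ⟨hxs, hx⟩]
    · simp [hxs]
  refine ⟨s.piecewise g h, ?_, h1, h2⟩
  rcases hst with ⟨hs, ht⟩ | ⟨hs, ht⟩
  · exact (hg.congr h1).union_of_isOpen (hh.congr h2) hs ht
  · exact (hg.congr h1).union_of_isClosed (hh.congr h2) hs ht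

theorem IsLogTrivial.image_Icc {φ : ℝ → ℂ} {a b : ℝ} (hab : a < b)
    (hφ : ContinuousOn φ (Icc a b)) (hinj : InjOn φ (Icc a b)) :
    IsLogTrivial (φ '' Icc a b) := by
  refine ⟨isCompact_Icc.image_of_continuousOn hφ, fun f hf hne ↦ ?_⟩
  let e := (iccHomeoI a b hab).symm
  let j : unitInterval → ℂ := fun t ↦ φ (e t)
  have hj : Continuous j := (continuousOn_iff_continuous_domRestrict.1 hφ).comp e.continuous
  have hjm : ∀ t, j t ∈ φ '' Icc a b := fun t ↦ mem_image_of_mem _ (e t).2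
  have hfj : Continuous fun t ↦ f (j t) := hf.comp_continuous hj hjm
  have hjinj : Function.Injective j := fun s t hst ↦
    e.injective (Subtype.ext (hinj (e s).2 (e t).2 hst))
  obtain ⟨G, hG, hGe, -⟩ := exists_continuous_exp_lift (X := Unit)
    (fun x ↦ f (j x.1)) (hfj.comp continuous_fst) (fun x ↦ hne _ (hjm _)) (fun _ ↦ log (f (j 0)))
    continuous_const (fun x ↦ exp_log (hne _ (hjm _)))
  obtain ⟨g, hg⟩ := ContinuousMap.exists_extension (hj.isClosedEmbedding hjinj)
    (⟨fun t ↦ G (t, ()), by fun_prop⟩ : C(unitInterval, ℂ))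
  refine ⟨g, g.continuous.continuousOn, ?_⟩
  rintro _ ⟨x, hx, rfl⟩
  have h1 : j (e.symm ⟨x, hx⟩) = φ x := by simp [j]
  have h2 := DFunLike.congr_fun hg (e.symm ⟨x, hx⟩)
  simp only [ContinuousMap.comp_apply, ContinuousMap.coe_mk, h1] at h2
  rw [h2, hGe, h1]

theorem IsLogTrivial.union {A B : Set ℂ} (hA : IsLogTrivial A) (hB : IsLogTrivial B) {p : ℂ}
    (hAB : A ∩ B = {p}) : IsLogTrivial (A ∪ B) := by
  refine ⟨hA.isCompact.union hB.isCompact, fun f hf hne ↦ ?_⟩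
  obtain ⟨g, hg, hge⟩ := hA.hasLogOn f (hf.mono subset_union_left) fun z hz ↦ hne z (.inl hz)
  obtain ⟨h, hh, hhe⟩ := hB.hasLogOn f (hf.mono subset_union_right) fun z hz ↦ hne z (.inr hz)
  have hp : p ∈ A ∩ B := hAB ▸ rfl
  obtain ⟨k, hk, hkg, hkh⟩ := exists_continuousOn_union (h := fun z ↦ h z + (g p - h p))
    (.inr ⟨hA.isCompact.isClosed, hB.isCompact.isClosed⟩) hg (by fun_prop)
    (by rw [hAB]; simp)
  refine ⟨k, hk, ?_⟩
  rintro z (hz | hz)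
  · rw [hkg hz, hge z hz]
  · rw [hkh hz, exp_add, exp_sub, hhe z hz, hge p hp.1, hhe p hp.2, div_self (hne p (.inl hp.1)),
      mul_one]

/-- A path from `p` to `q` yields a logarithm of `(z - p) / (z - q)` off the path. -/
theorem hasLogOn_div_of_path {φ : ℝ → ℂ} (hφ : ContinuousOn φ (Icc 0 1)) {s : Set ℂ}
    (hs : Disjoint s (φ '' Icc 0 1)) :
    HasLogOn (fun z ↦ (z - φ 1) / (z - φ 0)) s := by
  have hφ' : Continuous fun t : unitInterval ↦ φ t :=
    continuousOn_iff_continuous_domRestrict.1 hφ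
  have hne : ∀ (z : s) (t : unitInterval), (z : ℂ) - φ t ≠ 0 := fun z t h ↦
    disjoint_left.1 hs z.2 (sub_eq_zero.1 h ▸ mem_image_of_mem _ t.2)
  have hne0 : ∀ (z : s), (z : ℂ) - φ 0 ≠ 0 := fun z ↦ hne z 0
  obtain ⟨G, hG, hGe, -⟩ := exists_continuous_exp_lift (X := s)
    (fun x ↦ (x.2 - φ x.1) / (x.2 - φ 0))
    (.div₀ ((continuous_subtype_val.comp continuous_snd).sub (hφ'.comp continuous_fst))
      (by fun_prop) fun x ↦ hne0 x.2)
    (fun x ↦ div_ne_zero (hne _ _) (hne0 _)) (fun _ ↦ 0) continuous_const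
    (fun x ↦ by simp [div_self (hne0 x)])
  classical
  refine ⟨fun z ↦ if h : z ∈ s then G (1, ⟨z, h⟩) else 0, ?_, fun z hz ↦ by simp [hz, hGe]⟩
  rw [continuousOn_iff_continuous_domRestrict]
  have : Continuous fun z : s ↦ G (1, z) := by fun_prop
  convert this using 2 with z
  simp [domRestrict]

theorem HasLogOn.mul {f g : ℂ → ℂ} {s : Set ℂ} (hf : HasLogOn f s) (hg : HasLogOn g s) :
    HasLogOn (fun z ↦ f z * g z) s := by
  obtain ⟨F, hF, hFe⟩ := hf
  obtain ⟨G, hG, hGe⟩ := hg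
  exact ⟨fun z ↦ F z + G z, hF.add hG, fun z hz ↦ by rw [exp_add, hFe z hz, hGe z hz]⟩

theorem HasLogOn.inv {f : ℂ → ℂ} {s : Set ℂ} (hf : HasLogOn f s) :
    HasLogOn (fun z ↦ (f z)⁻¹) s := by
  obtain ⟨F, hF, hFe⟩ := hf
  exact ⟨fun z ↦ -F z, hF.neg, fun z hz ↦ by rw [exp_neg, hFe z hz]⟩

theorem HasLogOn.congr {f g : ℂ → ℂ} {s : Set ℂ} (hf : HasLogOn f s) (h : EqOn f g s) :
    HasLogOn g s := by
  obtain ⟨F, hF, hFe⟩ := hf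
  exact ⟨F, hF, fun z hz ↦ by rw [hFe z hz, h hz]⟩

/-- `(z - p) / (z - q)` winds around `p`. -/
theorem not_hasLogOn_div {p q : ℂ} (hpq : p ≠ q) :
    ¬ HasLogOn (fun z ↦ (z - p) / (z - q)) {p, q}ᶜ := by
  rintro ⟨g, hg, hge⟩
  have hd : p - q ≠ 0 := sub_ne_zero.2 hpq
  set d := p - q with hd'
  let c : ℝ → ℂ := fun θ ↦ p + d / 2 * exp (θ * I)
  have hslit : ∀ θ : ℝ, 1 + exp (θ * I) / 2 ∈ slitPlane := fun θ ↦
    mem_slitPlane_of_norm_lt_one (by simp [norm_exp_ofReal_mul_I]; norm_num)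
  have hc : ∀ θ, c θ ∈ ({p, q} : Set ℂ)ᶜ := by
    intro θ h
    rcases h with h | h
    · simp [c, hd] at h
    · have : d * (1 + exp (θ * I) / 2) = 0 := by
        have h' : p + d / 2 * exp (θ * I) = q := h
        linear_combination h' + hd'
      exact (mul_ne_zero hd (slitPlane_ne_zero (hslit θ))) this
  have hcc : Continuous c := by fun_prop
  refine not_exists_log_circle (m := 1) one_ne_zero (c := 1 / 2)
    (G := fun θ ↦ g (c θ) + log (1 + exp (θ * I) / 2)) ?_ ?_ ?_
  · exact (hg.comp_continuous hcc hc).add (Continuous.clog (by fun_prop) hslit)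
  · simp [c, exp_two_pi_mul_I]
  · intro θ
    have h1 := slitPlane_ne_zero (hslit θ)
    have h2 : c θ - q = d * (1 + exp (θ * I) / 2) := by simp only [c, hd']; ring
    rw [exp_add, exp_log h1, hge _ (hc θ)]
    beta_reduce
    rw [h2]
    simp only [c]
    rw [← div_div, div_mul_cancel₀ _ h1]
    field_simp
    simp

theorem isPreconnected_compl_closedBall (R : ℝ) :
    IsPreconnected (closedBall (0 : ℂ) R)ᶜ := by
  rcases lt_or_ge R 0 with hR | hR
  · simpa [closedBall_eq_empty.2 hR] using isPreconnected_univ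
  have : (closedBall (0 : ℂ) R)ᶜ = (fun x : ℝ × ℝ ↦ x.1 * exp (x.2 * I)) '' (Ioi R ×ˢ univ) := by
    ext z
    constructor
    · intro hz
      exact ⟨(‖z‖, arg z), ⟨by simpa using hz, mem_univ _⟩, norm_mul_exp_arg_mul_I z⟩
    · rintro ⟨⟨r, θ⟩, ⟨hr, -⟩, rfl⟩
      have hr : R < r := hr
      simpa [norm_exp_ofReal_mul_I] using hr.trans_le (le_abs_self r)
  rw [this]
  exact (isPreconnected_Ioi.prod isPreconnected_univ).image _ (by fun_prop)

theorem closure_connectedComponentIn_inter_subset {s : Set ℂ} (x : ℂ) :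
    closure (connectedComponentIn s x) ∩ s ⊆ connectedComponentIn s x := by
  rintro y ⟨hy, hys⟩
  rcases (connectedComponentIn s x).eq_empty_or_nonempty with h | h
  · simp [h] at hy
  have hx := connectedComponentIn_nonempty_iff.1 h
  have hsub : connectedComponentIn s x ∪ {y} ⊆ connectedComponentIn s x := by
    refine (isPreconnected_connectedComponentIn.subset_closure (t := connectedComponentIn s x ∪ {y})
      subset_union_left ?_).subset_connectedComponentIn (.inl (mem_connectedComponentIn hx)) ?_
    · exact union_subset subset_closure (singleton_subset_iff.2 hy)
    · exact union_subset (connectedComponentIn_subset _ _) (singleton_subset_iff.2 hys)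
  exact hsub (.inr rfl)

/-- Points of bounded components do not contribute to rational functions with a logarithm. -/
theorem eq_zero_of_hasLogOn_prod {K : Set ℂ} (hK : IsCompact K) {ι : Type*} [Fintype ι]
    {a : ι → ℂ} (ha : ∀ i, a i ∉ K) {m : ι → ℤ}
    (hlog : HasLogOn (fun z ↦ ∏ i, (z - a i) ^ m i) K) {i : ι}
    (hi : ∀ j, j ≠ i → a j ∉ connectedComponentIn Kᶜ (a i))
    (hb : Bornology.IsBounded (connectedComponentIn Kᶜ (a i))) : m i = 0 := by
  classical
  by_contra hm
  set U := connectedComponentIn Kᶜ (a i)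
  have hUo : IsOpen U := hK.isClosed.isOpen_compl.connectedComponentIn
  have haU : a i ∈ U := mem_connectedComponentIn (ha i)
  have hfr : ∀ z ∈ closure U, z ∉ U → z ∈ K := fun z hz hzU ↦ by
    by_contra hzK
    exact hzU (closure_connectedComponentIn_inter_subset _ ⟨hz, hzK⟩)
  obtain ⟨g, hg, hge⟩ := hlog
  obtain ⟨g', hg'⟩ := ContinuousMap.exists_restrict_eq hK.isClosed
    (⟨K.domRestrict g, continuousOn_iff_continuous_domRestrict.1 hg⟩ : C(K, ℂ))
  have hg'e : ∀ z ∈ K, g' z = g z := fun z hz ↦ DFunLike.congr_fun hg' ⟨z, hz⟩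
  have hja : ∀ j, j ≠ i → ∀ z ∈ closure U, z - a j ≠ 0 := fun j hj z hz h ↦ by
    rw [sub_eq_zero] at h
    subst h
    exact ha j (hfr _ hz (hi j hj))
  have hia : ∀ z, z ∉ U → z - a i ≠ 0 := fun z hz h ↦ hz (sub_eq_zero.1 h ▸ haU)
  let F₁ : ℂ → ℂ := fun z ↦ exp (g' z) * ∏ j ∈ Finset.univ.erase i, (z - a j) ^ (-m j)
  let F₂ : ℂ → ℂ := fun z ↦ (z - a i) ^ m i
  let F : ℂ → ℂ := U.piecewise F₁ F₂
  have hF1 : ContinuousOn F₁ (closure U) := by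
    refine (by fun_prop : Continuous fun z ↦ exp (g' z)).continuousOn.mul
      (continuousOn_finsetProd _ fun j hj ↦ ?_)
    exact ContinuousOn.zpow₀ (by fun_prop) _
      fun z hz ↦ .inl (hja j (Finset.ne_of_mem_erase hj) z hz)
  have hF2 : ContinuousOn F₂ (closure Uᶜ) := by
    rw [hUo.isClosed_compl.closure_eq]
    exact ContinuousOn.zpow₀ (by fun_prop) _ fun z hz ↦ .inl (hia z hz)
  have hF : Continuous F := by
    refine continuous_piecewise (fun z hz ↦ ?_) hF1 hF2
    rw [hUo.frontier_eq] at hz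
    have hzK := hfr z hz.1 hz.2
    simp only [F₁, F₂]
    rw [hg'e z hzK, hge z hzK]
    beta_reduce
    rw [← Finset.mul_prod_erase _ _ (Finset.mem_univ i), mul_assoc,
      ← Finset.prod_mul_distrib, Finset.prod_eq_one, mul_one]
    intro j hj
    rw [← zpow_add₀ (hja j (Finset.ne_of_mem_erase hj) z hz.1), add_neg_cancel, zpow_zero]
  have hFne : ∀ z, F z ≠ 0 := by
    intro z
    by_cases hz : z ∈ U
    · simp only [F, piecewise_eq_of_mem _ _ _ hz, F₁]
      exact mul_ne_zero (exp_ne_zero _) (Finset.prod_ne_zero_iff.2 fun j hj ↦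
        zpow_ne_zero _ (hja j (Finset.ne_of_mem_erase hj) z (subset_closure hz)))
    · simp only [F, piecewise_eq_of_notMem _ _ _ hz, F₂]
      exact zpow_ne_zero _ (hia z hz)
  obtain ⟨L, hL, hLe⟩ := exists_log_of_continuous hF hFne
  obtain ⟨R, hR⟩ := hb.subset_closedBall (a i)
  let S : ℝ := max R 0 + 1
  have hS : 0 < S := by positivity
  have hSR : R < S := by simp only [S]; linarith [le_max_left R 0]
  refine not_exists_log_circle hm (c := (S : ℂ) ^ m i)
    (G := fun θ ↦ L (a i + S * exp (θ * I))) (by fun_prop) (by simp [exp_two_pi_mul_I]) ?_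
  intro θ
  have hz : a i + S * exp (θ * I) ∉ U := fun h ↦ by
    have := hR h
    rw [mem_closedBall, dist_eq_norm, add_sub_cancel_left, norm_mul, norm_exp_ofReal_mul_I,
      mul_one, norm_real, Real.norm_of_nonneg hS.le] at this
    linarith
  rw [hLe]
  simp only [F, piecewise_eq_of_notMem _ _ _ hz, F₂]
  rw [add_sub_cancel_left, mul_zpow, exp_int_mul]

/-- A nontrivial rational function with zeros and poles in distinct components of the complement
of `K`, at least two exponents being nonzero, has no logarithm on `K`. -/
theorem eq_zero_or_eq_zero_of_hasLogOn_prod {K : Set ℂ} (hK : IsCompact K) {ι : Type*} [Fintype ι]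
    {a : ι → ℂ} (ha : ∀ i, a i ∉ K) {m : ι → ℤ}
    (hlog : HasLogOn (fun z ↦ ∏ i, (z - a i) ^ m i) K)
    (hsep : Pairwise fun i j ↦ a j ∉ connectedComponentIn Kᶜ (a i)) {i j : ι} (hij : i ≠ j) :
    m i = 0 ∨ m j = 0 := by
  by_cases hi : Bornology.IsBounded (connectedComponentIn Kᶜ (a i))
  · exact .inl (eq_zero_of_hasLogOn_prod hK ha hlog (fun k hk ↦ hsep hk.symm) hi)
  by_cases hj : Bornology.IsBounded (connectedComponentIn Kᶜ (a j))
  · exact .inr (eq_zero_of_hasLogOn_prod hK ha hlog (fun k hk ↦ hsep hk.symm) hj)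
  exfalso
  obtain ⟨R, hR⟩ := hK.isBounded.subset_closedBall 0
  have key : ∀ k, ¬ Bornology.IsBounded (connectedComponentIn Kᶜ (a k)) →
      (closedBall (0 : ℂ) R)ᶜ ⊆ connectedComponentIn Kᶜ (a k) := by
    intro k hk
    have : ¬ connectedComponentIn Kᶜ (a k) ⊆ closedBall 0 R := fun h ↦
      hk (isBounded_closedBall.subset h)
    obtain ⟨x, hx, hxR⟩ := not_subset.1 this
    rw [connectedComponentIn_eq hx]
    exact (isPreconnected_compl_closedBall R).subset_connectedComponentIn hxR
      (compl_subset_compl.2 hR)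
  have hne : ((|R| + 1 : ℝ) : ℂ) ∈ (closedBall (0 : ℂ) R)ᶜ := by
    have : R < |R| + 1 := by linarith [le_abs_self R]
    simp only [mem_compl_iff, mem_closedBall_zero_iff, norm_real, not_le]
    exact this.trans_le (le_abs_self _)
  have h1 := connectedComponentIn_eq (key i hi hne)
  have h2 := connectedComponentIn_eq (key j hj hne)
  exact hsep hij (h1 ▸ h2 ▸ mem_connectedComponentIn (ha j))

theorem IsLogTrivial.isPreconnected_compl {K : Set ℂ} (hK : IsLogTrivial K) :
    IsPreconnected Kᶜ := by
  refine isPreconnected_of_forall_pair fun x hx y hy ↦ ?_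
  by_cases hy' : y ∈ connectedComponentIn Kᶜ x
  · exact ⟨_, connectedComponentIn_subset _ _, mem_connectedComponentIn hx, hy',
      isPreconnected_connectedComponentIn⟩
  exfalso
  have hx' : x ∉ connectedComponentIn Kᶜ y := fun h ↦
    hy' (connectedComponentIn_eq h ▸ mem_connectedComponentIn hy)
  have hne : ∀ i : Fin 2, ∀ z ∈ K, z - ![x, y] i ≠ 0 := by
    intro i z hz h
    obtain rfl := sub_eq_zero.1 h
    fin_cases i
    · exact hx hz
    · exact hy hz
  have := eq_zero_or_eq_zero_of_hasLogOn_prod hK.isCompact (a := ![x, y]) (m := ![1, 1])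
    (by simpa [Fin.forall_fin_two] using ⟨hx, hy⟩)
    (hK.hasLogOn _ (continuousOn_finsetProd _ fun i _ ↦ ContinuousOn.zpow₀ (by fun_prop) _
      fun z hz ↦ .inl (hne i z hz))
      fun z hz ↦ Finset.prod_ne_zero_iff.2 fun i _ ↦ zpow_ne_zero _ (hne i z hz))
    (by
      intro i j hij
      fin_cases i <;> fin_cases j <;> simp_all)
    (zero_ne_one (α := Fin 2))
  simp at this

/-- If closed sets `A` and `B` each join `p` to `q`, and meet only there, then `A ∪ B` separates
the plane. -/
theorem not_isPreconnected_compl_union {A B : Set ℂ} (hA : IsClosed A) (hB : IsClosed B)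
    {p q : ℂ} (hpq : p ≠ q) (hAB : A ∩ B = {p, q})
    (hAlog : HasLogOn (fun z ↦ (z - p) / (z - q)) Aᶜ)
    (hBlog : HasLogOn (fun z ↦ (z - p) / (z - q)) Bᶜ) :
    ¬ IsPreconnected (A ∪ B)ᶜ := by
  intro hpre
  apply not_hasLogOn_div hpq
  rw [← hAB, compl_inter]
  rw [compl_union] at hpre
  obtain ⟨g, hg, hge⟩ := hAlog
  obtain ⟨h, hh, hhe⟩ := hBlog
  have hpA : p ∈ A ∩ B := hAB ▸ .inl rfl
  have hqA : q ∈ A ∩ B := hAB ▸ .inr rfl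
  obtain ⟨c, hc1, hc⟩ : ∃ c : ℂ, exp c = 1 ∧ EqOn g (fun z ↦ h z + c) (Aᶜ ∩ Bᶜ) := by
    rcases (Aᶜ ∩ Bᶜ).eq_empty_or_nonempty with he | ⟨x, hx⟩
    · exact ⟨0, exp_zero, by simp [he]⟩
    have hc : exp (g x - h x) = 1 := by
      rw [exp_sub, hge x hx.1, hhe x hx.2, div_self]
      exact div_ne_zero (sub_ne_zero.2 fun h ↦ hx.1 (h ▸ hpA.1))
        (sub_ne_zero.2 fun h ↦ hx.1 (h ▸ hqA.1))
    refine ⟨g x - h x, hc, eqOn_of_exp_eq hpre (hg.mono inter_subset_left)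
      ((hh.mono inter_subset_right).add continuousOn_const) (fun z hz ↦ ?_) hx (by ring)⟩
    rw [exp_add, hc, mul_one, hge z hz.1, hhe z hz.2]
  obtain ⟨k, hk, hkg, hkh⟩ := exists_continuousOn_union
    (.inl ⟨hA.isOpen_compl, hB.isOpen_compl⟩) hg (h := fun z ↦ h z + c) (hh.add continuousOn_const) hc
  refine ⟨k, hk, ?_⟩
  rintro z (hz | hz)
  · rw [hkg hz, hge z hz]
  · rw [hkh hz, exp_add, hc1, mul_one, hhe z hz]

theorem exists_int_relation {ι κ : Type*} [Fintype ι] [Fintype κ]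
    (h : Fintype.card κ < Fintype.card ι) (n : ι → κ → ℤ) :
    ∃ m : ι → ℤ, (∀ k, ∑ i, m i * n i k = 0) ∧ m ≠ 0 := by
  have hn : ¬ LinearIndependent ℤ n := fun hli ↦ by
    have := hli.fintype_card_le_finrank
    rw [Module.finrank_fintype_fun_eq_card] at this
    omega
  obtain ⟨m, hm, i, hi⟩ := Fintype.not_linearIndependent_iff.1 hn
  refine ⟨m, fun k ↦ ?_, fun h ↦ hi (congrFun h i)⟩
  simpa using congrFun hm k

/-- The complement of three arcs with common endpoints has at most three components. -/
theorem exists_mem_connectedComponentIn_of_four {A : Fin 3 → Set ℂ}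
    (hA : ∀ s, IsLogTrivial (A s)) {p q : ℂ}
    (hAA : ∀ s t, s ≠ t → A s ∩ A t = {p, q}) (a : Fin 4 → ℂ) (ha : ∀ i, a i ∉ ⋃ s, A s) :
    ∃ i j, i ≠ j ∧ a j ∈ connectedComponentIn (⋃ s, A s)ᶜ (a i) := by
  by_contra! hsep
  have hp : ∀ s, p ∈ A s := fun s ↦ by
    have : p ∈ A s ∩ A (s + 1) := by rw [hAA s (s + 1) (by decide +revert)]; simp
    exact this.1
  have hq : ∀ s, q ∈ A s := fun s ↦ by
    have : q ∈ A s ∩ A (s + 1) := by rw [hAA s (s + 1) (by decide +revert)]; simp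
    exact this.1
  have hne : ∀ i s, ∀ z ∈ A s, z - a i ≠ 0 := fun i s z hz h ↦
    ha i (mem_iUnion.2 ⟨s, sub_eq_zero.1 h ▸ hz⟩)
  have hex : ∀ i s, ∃ g : ℂ → ℂ, ContinuousOn g (A s) ∧ g p = 0 ∧
      ∀ z ∈ A s, exp (g z) = (z - a i) / (p - a i) := by
    intro i s
    obtain ⟨g, hg, hge⟩ := (hA s).hasLogOn (fun z ↦ z - a i) (by fun_prop) (hne i s)
    refine ⟨fun z ↦ g z - g p, by fun_prop, sub_self _, fun z hz ↦ ?_⟩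
    rw [exp_sub, hge z hz, hge p (hp s)]
  choose g hg hgp hge using hex
  have hnq : ∀ i s, ∃ n : ℤ, g i s q = g i 0 q + n * (2 * Real.pi * I) := fun i s ↦
    exp_eq_exp_iff_exists_int.1 (by rw [hge i s q (hq s), hge i 0 q (hq 0)])
  choose n hn using hnq
  obtain ⟨m, hm, hm0⟩ := exists_int_relation (κ := Option (Fin 2)) (by simp)
    fun i (k : Option (Fin 2)) ↦ k.elim 1 fun s ↦ n i s.succ
  have hmsum : ∑ i, m i = 0 := by simpa using hm none
  have hmn : ∀ s, ∑ i, m i * n i s = 0 := by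
    refine Fin.cases ?_ fun s ↦ hm (some s)
    have h0 : ∀ i, n i 0 = 0 := fun i ↦ by
      have := hn i 0
      simpa [Real.pi_ne_zero] using this
    simp [h0]
  let G : Fin 3 → ℂ → ℂ := fun s z ↦ ∑ i, m i * g i s z
  have hG : ∀ s, ContinuousOn (G s) (A s) := fun s ↦
    continuousOn_finsetSum _ fun i _ ↦ continuousOn_const.mul (hg i s)
  have hGpq : ∀ s, ∀ t, s ≠ t → EqOn (G s) (G t) (A s ∩ A t) := by
    have hGq : ∀ s, G s q = G 0 q := fun s ↦ by
      have : (∑ i, m i * n i s : ℂ) = 0 := by exact_mod_cast hmn s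
      simp only [G, hn _ s, mul_add, Finset.sum_add_distrib, ← mul_assoc, ← Finset.sum_mul, this]
      simp
    intro s t hst
    rw [hAA s t hst]
    rintro z (rfl | rfl)
    · simp [G, hgp]
    · rw [hGq s, hGq t]
  have hcl : ∀ s, IsClosed (A s) := fun s ↦ (hA s).isCompact.isClosed
  obtain ⟨k, hk, hk0, hk1⟩ := exists_continuousOn_union (.inr ⟨hcl 0, hcl 1⟩) (hG 0) (hG 1)
    (hGpq 0 1 (by decide))
  obtain ⟨l, hl, hl01, hl2⟩ := exists_continuousOn_union (.inr ⟨(hcl 0).union (hcl 1), hcl 2⟩)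
    hk (hG 2) (by
      rintro z ⟨hz | hz, hz2⟩
      · rw [hk0 hz, hGpq 0 2 (by decide) ⟨hz, hz2⟩]
      · rw [hk1 hz, hGpq 1 2 (by decide) ⟨hz, hz2⟩])
  have hK : ⋃ s, A s = A 0 ∪ A 1 ∪ A 2 := by
    ext z; simp [Fin.exists_fin_succ, or_assoc]
  have hlG : ∀ s, EqOn l (G s) (A s) := by
    intro s z hz
    fin_cases s
    · exact (hl01 (.inl hz)).trans (hk0 hz)
    · exact (hl01 (.inr hz)).trans (hk1 hz)
    · exact hl2 hz
  have hlog : HasLogOn (fun z ↦ ∏ i, (z - a i) ^ m i) (⋃ s, A s) := by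
    have hc : ∏ i, (p - a i) ^ m i ≠ 0 :=
      Finset.prod_ne_zero_iff.2 fun i _ ↦ zpow_ne_zero _ (hne i 0 p (hp 0))
    refine ⟨fun z ↦ l z + log (∏ i, (p - a i) ^ m i), by rw [hK]; fun_prop, fun z hz ↦ ?_⟩
    obtain ⟨s, hs⟩ := mem_iUnion.1 hz
    rw [exp_add, exp_log hc, hlG s hs, exp_sum, ← Finset.prod_mul_distrib]
    refine Finset.prod_congr rfl fun i _ ↦ ?_
    rw [exp_int_mul, hge i s z hs, div_zpow, div_mul_cancel₀]
    exact zpow_ne_zero _ (hne i 0 p (hp 0))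
  have hKc : IsCompact (⋃ s, A s) := isCompact_iUnion fun s ↦ (hA s).isCompact
  obtain ⟨i, hi⟩ := Function.ne_iff.1 hm0
  refine hi ?_
  have hz : ∀ j, i ≠ j → m j = 0 := fun j hij ↦
    (eq_zero_or_eq_zero_of_hasLogOn_prod hKc ha hlog (fun i j hij ↦ hsep i j hij) hij).resolve_left
      hi
  rwa [Finset.sum_eq_single i (fun j _ hj ↦ hz j hj.symm) (by simp)] at hmsum

end Logarithms

/-- Three arcs in `ℂ` from `p` to `q`, meeting only at their endpoints. The arc number `s` passes
through `z s`, and consists of `φ s` from `z s` to `p` and `ψ s` from `z s` to `q`. -/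
structure IsThetaCurve (z : Fin 3 → ℂ) (p q : ℂ) (φ ψ : Fin 3 → ℝ → ℂ) : Prop where
  injective : Function.Injective z
  ne : p ≠ q
  contφ : ∀ s, ContinuousOn (φ s) (Icc 0 1)
  injφ : ∀ s, InjOn (φ s) (Icc 0 1)
  contψ : ∀ s, ContinuousOn (ψ s) (Icc 0 1)
  injψ : ∀ s, InjOn (ψ s) (Icc 0 1)
  φ_zero : ∀ s, φ s 0 = z s
  φ_one : ∀ s, φ s 1 = p
  ψ_zero : ∀ s, ψ s 0 = z s
  ψ_one : ∀ s, ψ s 1 = q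
  disjφ : ∀ s t, s ≠ t → φ s '' Ico 0 1 ∩ φ t '' Ico 0 1 = ∅
  disjψ : ∀ s t, s ≠ t → ψ s '' Ico 0 1 ∩ ψ t '' Ico 0 1 = ∅
  meet : (⋃ s, φ s '' Icc 0 1) ∩ (⋃ s, ψ s '' Icc 0 1) = range z

namespace IsThetaCurve

variable {z : Fin 3 → ℂ} {p q : ℂ} {φ ψ : Fin 3 → ℝ → ℂ}

theorem symm (h : IsThetaCurve z p q φ ψ) : IsThetaCurve z q p ψ φ :=
  ⟨h.injective, h.ne.symm, h.contψ, h.injψ, h.contφ, h.injφ, h.ψ_zero, h.ψ_one, h.φ_zero,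
    h.φ_one, h.disjψ, h.disjφ, inter_comm _ _ ▸ h.meet⟩

theorem mem_φ (h : IsThetaCurve z p q φ ψ) (s : Fin 3) : z s ∈ φ s '' Icc 0 1 :=
  ⟨0, by simp, h.φ_zero s⟩

theorem left_mem_φ (h : IsThetaCurve z p q φ ψ) (s : Fin 3) : p ∈ φ s '' Icc 0 1 :=
  ⟨1, by simp, h.φ_one s⟩

theorem ne_left (h : IsThetaCurve z p q φ ψ) (s : Fin 3) : z s ≠ p := fun hs ↦ by
  rw [← h.φ_zero s, ← h.φ_one s] at hs
  exact zero_ne_one (h.injφ s (by simp) (by simp) hs)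

theorem inter_φ (h : IsThetaCurve z p q φ ψ) {s t : Fin 3} (hst : s ≠ t) :
    φ s '' Icc 0 1 ∩ φ t '' Icc 0 1 = {p} := by
  refine subset_antisymm ?_ (singleton_subset_iff.2 ⟨h.left_mem_φ s, h.left_mem_φ t⟩)
  rintro x ⟨⟨a, ha, rfl⟩, b, hb, hab⟩
  rcases ha.2.eq_or_lt with rfl | ha1
  · exact h.φ_one s
  rcases hb.2.eq_or_lt with rfl | hb1
  · exact hab ▸ h.φ_one t
  · exact absurd (h.disjφ s t hst)
      (nonempty_iff_ne_empty.1 ⟨_, ⟨a, ⟨ha.1, ha1⟩, rfl⟩, b, ⟨hb.1, hb1⟩, hab⟩)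

theorem eq_of_mem_φ (h : IsThetaCurve z p q φ ψ) {r s : Fin 3} (hr : z r ∈ φ s '' Icc 0 1) :
    r = s := by
  by_contra hrs
  exact h.ne_left r ((h.inter_φ hrs).subset ⟨h.mem_φ r, hr⟩)

theorem inter_φ_ψ (h : IsThetaCurve z p q φ ψ) (s : Fin 3) :
    φ s '' Icc 0 1 ∩ ψ s '' Icc 0 1 = {z s} := by
  refine subset_antisymm ?_ (singleton_subset_iff.2 ⟨h.mem_φ s, h.symm.mem_φ s⟩)
  rintro x ⟨hx, hx'⟩
  obtain ⟨r, rfl⟩ := h.meet.subset ⟨mem_iUnion.2 ⟨s, hx⟩, mem_iUnion.2 ⟨s, hx'⟩⟩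
  rw [h.eq_of_mem_φ hx, mem_singleton_iff]

theorem inter_φ_ψ_of_ne (h : IsThetaCurve z p q φ ψ) {s t : Fin 3} (hst : s ≠ t) :
    φ s '' Icc 0 1 ∩ ψ t '' Icc 0 1 = ∅ := by
  refine subset_empty_iff.1 ?_
  rintro x ⟨hx, hx'⟩
  obtain ⟨r, rfl⟩ := h.meet.subset ⟨mem_iUnion.2 ⟨s, hx⟩, mem_iUnion.2 ⟨t, hx'⟩⟩
  exact hst (h.eq_of_mem_φ hx ▸ h.symm.eq_of_mem_φ hx')

theorem left_notMem_ψ (h : IsThetaCurve z p q φ ψ) (s : Fin 3) : p ∉ ψ s '' Icc 0 1 := fun hp ↦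
  h.ne_left s ((h.inter_φ_ψ s).subset ⟨h.left_mem_φ s, hp⟩).symm

theorem inter_arc (h : IsThetaCurve z p q φ ψ) {s t : Fin 3} (hst : s ≠ t) :
    (φ s '' Icc 0 1 ∪ ψ s '' Icc 0 1) ∩ (φ t '' Icc 0 1 ∪ ψ t '' Icc 0 1) = {p, q} := by
  rw [union_inter_distrib_right, inter_union_distrib_left, inter_union_distrib_left,
    h.inter_φ hst, h.symm.inter_φ hst, h.inter_φ_ψ_of_ne hst, h.symm.inter_φ_ψ_of_ne hst,
    union_empty, empty_union, singleton_union]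

theorem isLogTrivial_φ (h : IsThetaCurve z p q φ ψ) (s : Fin 3) {ε : ℝ} (hε : 0 ≤ ε)
    (hε1 : ε < 1) : IsLogTrivial (φ s '' Icc ε 1) :=
  have hsub : Icc ε 1 ⊆ Icc 0 1 := Icc_subset_Icc_left hε
  .image_Icc hε1 ((h.contφ s).mono hsub) ((h.injφ s).mono hsub)

theorem isLogTrivial_arc (h : IsThetaCurve z p q φ ψ) (s : Fin 3) :
    IsLogTrivial (φ s '' Icc 0 1 ∪ ψ s '' Icc 0 1) :=
  (h.isLogTrivial_φ s le_rfl one_pos).union (h.symm.isLogTrivial_φ s le_rfl one_pos)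
    (h.inter_φ_ψ s)

theorem hasLogOn_compl_arc (h : IsThetaCurve z p q φ ψ) (s : Fin 3) :
    HasLogOn (fun w ↦ (w - p) / (w - q)) (φ s '' Icc 0 1 ∪ ψ s '' Icc 0 1)ᶜ := by
  have h1 := hasLogOn_div_of_path (h.contφ s) (s := (φ s '' Icc 0 1 ∪ ψ s '' Icc 0 1)ᶜ)
    (disjoint_compl_left.mono_right subset_union_left)
  have h2 := hasLogOn_div_of_path (h.contψ s) (s := (φ s '' Icc 0 1 ∪ ψ s '' Icc 0 1)ᶜ)
    (disjoint_compl_left.mono_right subset_union_right)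
  refine (h1.mul h2.inv).congr fun w hw ↦ ?_
  have hwz : w - z s ≠ 0 := fun hw' ↦ hw (.inl (sub_eq_zero.1 hw' ▸ h.mem_φ s))
  simp only [h.φ_zero, h.φ_one, h.ψ_zero, h.ψ_one, inv_div]
  rw [div_mul_div_cancel₀ hwz]

/-- Trimming the path `φ s` near `z s`, so as to avoid a closed set. -/
theorem exists_image_Icc_disjoint (h : IsThetaCurve z p q φ ψ) (s : Fin 3) {C : Set ℂ}
    (hC : IsClosed C) (hs : z s ∉ C) :
    ∃ ε : ℝ, 0 < ε ∧ ε < 1 ∧ Disjoint (φ s '' Icc 0 ε) C := by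
  have h0 : (0 : ℝ) ∈ Icc (0 : ℝ) 1 := by simp
  have := (h.contφ s 0 h0).preimage_mem_nhdsWithin (hC.isOpen_compl.mem_nhds
    (by rwa [h.φ_zero, mem_compl_iff]))
  obtain ⟨δ, hδ, hδs⟩ := mem_nhdsWithin_iff.1 this
  refine ⟨min (δ / 2) (1 / 2), by positivity, by
    linarith [min_le_right (δ / 2) (1 / 2 : ℝ)], disjoint_left.2 ?_⟩
  rintro _ ⟨t, ht, rfl⟩
  have h1 := ht.2.trans (min_le_left _ _)
  have h2 := ht.2.trans (min_le_right _ _)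
  refine hδs ⟨?_, ht.1, by linarith⟩
  rw [mem_ball, Real.dist_eq, sub_zero, abs_of_nonneg ht.1]
  linarith

theorem mem_closure_component (h : IsThetaCurve z p q φ ψ) {s t : Fin 3} (hst : s ≠ t) {y : ℂ}
    (hy : y ∈ ((φ s '' Icc 0 1 ∪ ψ s '' Icc 0 1) ∪ (φ t '' Icc 0 1 ∪ ψ t '' Icc 0 1))ᶜ) :
    z s ∈ closure (connectedComponentIn
      ((φ s '' Icc 0 1 ∪ ψ s '' Icc 0 1) ∪ (φ t '' Icc 0 1 ∪ ψ t '' Icc 0 1))ᶜ y) := by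
  by_contra hs
  set J := (φ s '' Icc 0 1 ∪ ψ s '' Icc 0 1) ∪ (φ t '' Icc 0 1 ∪ ψ t '' Icc 0 1) with hJ
  set Y := connectedComponentIn Jᶜ y
  have hJc : IsClosed J :=
    ((h.isLogTrivial_arc s).isCompact.union (h.isLogTrivial_arc t).isCompact).isClosed
  obtain ⟨ε, hε, hε1, hεd⟩ := h.exists_image_Icc_disjoint s isClosed_closure hs
  obtain ⟨δ, hδ, hδ1, hδd⟩ := h.symm.exists_image_Icc_disjoint s isClosed_closure hs
  have hφsub : φ s '' Icc ε 1 ⊆ φ s '' Icc 0 1 := image_mono (Icc_subset_Icc_left hε.le)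
  have hψsub : ψ s '' Icc δ 1 ⊆ ψ s '' Icc 0 1 := image_mono (Icc_subset_Icc_left hδ.le)
  have hzφ : z s ∉ φ s '' Icc ε 1 := by
    rintro ⟨a, ha, ha'⟩
    rw [← h.φ_zero s] at ha'
    have := h.injφ s ⟨hε.le.trans ha.1, ha.2⟩ (by simp) ha'
    linarith [ha.1]
  have hzψ : z s ∉ ψ s '' Icc δ 1 := by
    rintro ⟨a, ha, ha'⟩
    rw [← h.ψ_zero s] at ha'
    have := h.injψ s ⟨hδ.le.trans ha.1, ha.2⟩ (by simp) ha'
    linarith [ha.1]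
  have h1 : (φ t '' Icc 0 1 ∪ ψ t '' Icc 0 1) ∩ φ s '' Icc ε 1 = {p} := by
    refine subset_antisymm ?_ (singleton_subset_iff.2
      ⟨.inl (h.left_mem_φ t), 1, ⟨hε1.le, le_rfl⟩, h.φ_one s⟩)
    rintro x ⟨hx | hx, hx'⟩
    · exact (h.inter_φ hst).subset ⟨hφsub hx', hx⟩
    · exact ((h.inter_φ_ψ_of_ne hst).subset ⟨hφsub hx', hx⟩).elim
  have h2 : (φ t '' Icc 0 1 ∪ ψ t '' Icc 0 1 ∪ φ s '' Icc ε 1) ∩ ψ s '' Icc δ 1 = {q} := by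
    refine subset_antisymm ?_ (singleton_subset_iff.2
      ⟨.inl (.inr (h.symm.left_mem_φ t)), 1, ⟨hδ1.le, le_rfl⟩, h.ψ_one s⟩)
    rintro x ⟨(hx | hx) | hx, hx'⟩
    · exact ((h.inter_φ_ψ_of_ne hst.symm).subset ⟨hx, hψsub hx'⟩).elim
    · exact (h.symm.inter_φ hst).subset ⟨hψsub hx', hx⟩
    · have := (h.inter_φ_ψ s).subset ⟨hφsub hx, hψsub hx'⟩
      rw [mem_singleton_iff] at this
      exact (hzφ (this ▸ hx)).elim
  have hC := ((h.isLogTrivial_arc t).union (h.isLogTrivial_φ s hε.le hε1) h1).union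
    (h.symm.isLogTrivial_φ s hδ.le hδ1) h2
  set C := φ t '' Icc 0 1 ∪ ψ t '' Icc 0 1 ∪ φ s '' Icc ε 1 ∪ ψ s '' Icc δ 1
  have hCJ : C ⊆ J := by
    rintro x ((hx | hx) | hx)
    · exact .inr hx
    · exact .inl (.inl (hφsub hx))
    · exact .inl (.inr (hψsub hx))
  have hsub : Cᶜ ⊆ Y := by
    refine hC.isPreconnected_compl.subset_of_closure_inter_subset
      hJc.isOpen_compl.connectedComponentIn
      ⟨y, fun hyC ↦ hy (hCJ hyC), mem_connectedComponentIn hy⟩ ?_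
    rintro x ⟨hx, hxC⟩
    refine closure_connectedComponentIn_inter_subset y ⟨hx, ?_⟩
    rintro ((⟨a, ha, rfl⟩ | ⟨a, ha, rfl⟩) | hxt)
    · rcases le_total a ε with hae | hae
      · exact disjoint_left.1 hεd ⟨a, ⟨ha.1, hae⟩, rfl⟩ hx
      · exact hxC (.inl (.inr ⟨a, ⟨hae, ha.2⟩, rfl⟩))
    · rcases le_total a δ with hae | hae
      · exact disjoint_left.1 hδd ⟨a, ⟨ha.1, hae⟩, rfl⟩ hx
      · exact hxC (.inr ⟨a, ⟨hae, ha.2⟩, rfl⟩)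
    · exact hxC (.inl (.inl hxt))
  have hzC : z s ∉ C := by
    rintro ((hx | hx) | hx)
    · rcases hx with hx | hx
      · exact hst (h.eq_of_mem_φ hx)
      · exact hst (h.symm.eq_of_mem_φ hx)
    · exact hzφ hx
    · exact hzψ hx
  exact hs (subset_closure (hsub hzC))

/-- Apart from its endpoint `p`, the path `φ k` avoids the other arcs. -/
theorem notMem_of_mem_image_Ico (h : IsThetaCurve z p q φ ψ) {k s : Fin 3} (hks : k ≠ s) {x : ℂ}
    (hx : x ∈ φ k '' Ico 0 1) : x ∉ φ s '' Icc 0 1 ∪ ψ s '' Icc 0 1 := by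
  intro hxs
  obtain ⟨a, ha, rfl⟩ := hx
  have hak : φ k a ∈ φ k '' Icc 0 1 := ⟨a, ⟨ha.1, ha.2.le⟩, rfl⟩
  rcases (h.inter_arc hks).subset ⟨.inl hak, hxs⟩ with hp | hq
  · rw [← h.φ_one k] at hp
    exact ha.2.ne (h.injφ k ⟨ha.1, ha.2.le⟩ (by simp) hp)
  · rw [mem_singleton_iff] at hq
    exact h.symm.left_notMem_ψ k (hq ▸ hak)

theorem exists_component (h : IsThetaCurve z p q φ ψ) {k s t : Fin 3} (hks : k ≠ s) (hkt : k ≠ t)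
    (hst : s ≠ t) :
    ∃ y ∈ (⋃ s, φ s '' Icc 0 1 ∪ ψ s '' Icc 0 1)ᶜ,
      z s ∈ closure (connectedComponentIn (⋃ s, φ s '' Icc 0 1 ∪ ψ s '' Icc 0 1)ᶜ y) ∧
      z t ∈ closure (connectedComponentIn (⋃ s, φ s '' Icc 0 1 ∪ ψ s '' Icc 0 1)ᶜ y) ∧
      z k ∉ closure (connectedComponentIn (⋃ s, φ s '' Icc 0 1 ∪ ψ s '' Icc 0 1)ᶜ y) := by
  set K := ⋃ s, φ s '' Icc 0 1 ∪ ψ s '' Icc 0 1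
  set J := (φ s '' Icc 0 1 ∪ ψ s '' Icc 0 1) ∪ (φ t '' Icc 0 1 ∪ ψ t '' Icc 0 1) with hJ
  have hcl : ∀ s, IsClosed (φ s '' Icc 0 1 ∪ ψ s '' Icc 0 1) :=
    fun s ↦ (h.isLogTrivial_arc s).isCompact.isClosed
  have hnp : ¬ IsPreconnected Jᶜ := not_isPreconnected_compl_union (hcl s) (hcl t) h.ne
    (h.inter_arc hst) (h.hasLogOn_compl_arc s) (h.hasLogOn_compl_arc t)
  let B := φ k '' Ico 0 1 ∪ ψ k '' Ico 0 1
  have hBJ : B ⊆ Jᶜ := by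
    rintro x (hx | hx) (hxJ | hxJ)
    · exact h.notMem_of_mem_image_Ico hks hx hxJ
    · exact h.notMem_of_mem_image_Ico hkt hx hxJ
    · exact h.symm.notMem_of_mem_image_Ico hks hx (union_comm _ _ ▸ hxJ)
    · exact h.symm.notMem_of_mem_image_Ico hkt hx (union_comm _ _ ▸ hxJ)
  have hzB : z k ∈ φ k '' Ico 0 1 := ⟨0, by simp, h.φ_zero k⟩
  have hBpre : IsPreconnected B := IsPreconnected.union (z k) hzB ⟨0, by simp, h.ψ_zero k⟩
    (isPreconnected_Ico.image _ ((h.contφ k).mono Ico_subset_Icc_self))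
    (isPreconnected_Ico.image _ ((h.contψ k).mono Ico_subset_Icc_self))
  have hzJ : z k ∈ Jᶜ := hBJ (.inl hzB)
  have hBsub : B ⊆ connectedComponentIn Jᶜ (z k) :=
    hBpre.subset_connectedComponentIn (.inl hzB) hBJ
  obtain ⟨y, hyJ, hyz⟩ : ∃ y ∈ Jᶜ, y ∉ connectedComponentIn Jᶜ (z k) := by
    by_contra! hall
    exact hnp (subset_antisymm (connectedComponentIn_subset _ _) hall ▸
      isPreconnected_connectedComponentIn)
  have hJK : J ⊆ K := union_subset (subset_iUnion (fun s ↦ φ s '' Icc 0 1 ∪ ψ s '' Icc 0 1) s)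
    (subset_iUnion (fun s ↦ φ s '' Icc 0 1 ∪ ψ s '' Icc 0 1) t)
  have hKJ : K ⊆ J ∪ B := by
    refine iUnion_subset fun r ↦ ?_
    obtain rfl | rfl | rfl : r = k ∨ r = s ∨ r = t := by
      clear * - hks hkt hst
      decide +revert
    · rintro x (⟨a, ha, rfl⟩ | ⟨a, ha, rfl⟩)
      · rcases ha.2.eq_or_lt with rfl | ha1
        · exact .inl (.inl (.inl (h.φ_one r ▸ h.left_mem_φ s)))
        · exact .inr (.inl ⟨a, ⟨ha.1, ha1⟩, rfl⟩)
      · rcases ha.2.eq_or_lt with rfl | ha1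
        · exact .inl (.inl (.inr (h.ψ_one r ▸ h.symm.left_mem_φ s)))
        · exact .inr (.inr ⟨a, ⟨ha.1, ha1⟩, rfl⟩)
    · exact fun x hx ↦ .inl (.inl hx)
    · exact fun x hx ↦ .inl (.inr hx)
  have hzY : z k ∉ connectedComponentIn Jᶜ y := fun hz ↦
    hyz (connectedComponentIn_eq hz ▸ mem_connectedComponentIn hyJ)
  have hYK : connectedComponentIn Jᶜ y ⊆ Kᶜ := by
    intro x hx hxK
    rcases hKJ hxK with hxJ | hxB
    · exact connectedComponentIn_subset _ _ hx hxJ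
    · refine hzY ?_
      rw [connectedComponentIn_eq hx, ← connectedComponentIn_eq (hBsub hxB)]
      exact mem_connectedComponentIn hzJ
  have hYy : y ∈ connectedComponentIn Jᶜ y := mem_connectedComponentIn hyJ
  have hY : connectedComponentIn Kᶜ y = connectedComponentIn Jᶜ y :=
    subset_antisymm (connectedComponentIn_mono y (compl_subset_compl.2 hJK))
      (isPreconnected_connectedComponentIn.subset_connectedComponentIn hYy hYK)
  refine ⟨y, hYK hYy, ?_⟩
  rw [hY]
  refine ⟨h.mem_closure_component hst hyJ, ?_, fun hz ↦
    hzY (closure_connectedComponentIn_inter_subset y ⟨hz, hzJ⟩)⟩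
  rw [hJ, union_comm] at hyJ ⊢
  exact h.mem_closure_component hst.symm hyJ

theorem exists_components (h : IsThetaCurve z p q φ ψ) :
    ∃ y : Fin 3 → ℂ, (∀ k, y k ∈ (⋃ s, φ s '' Icc 0 1 ∪ ψ s '' Icc 0 1)ᶜ) ∧
      (∀ k, closure (connectedComponentIn (⋃ s, φ s '' Icc 0 1 ∪ ψ s '' Icc 0 1)ᶜ (y k)) ∩
        range z = z '' {k}ᶜ) ∧
      ∀ x ∈ (⋃ s, φ s '' Icc 0 1 ∪ ψ s '' Icc 0 1)ᶜ, ∃ k,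
        connectedComponentIn (⋃ s, φ s '' Icc 0 1 ∪ ψ s '' Icc 0 1)ᶜ x =
          connectedComponentIn (⋃ s, φ s '' Icc 0 1 ∪ ψ s '' Icc 0 1)ᶜ (y k) := by
  choose y hyK hy1 hy2 hyk using fun k : Fin 3 ↦
    h.exists_component (k := k) (s := k + 1) (t := k + 2) (by decide +revert) (by decide +revert)
      (by decide +revert)
  set K := ⋃ s, φ s '' Icc 0 1 ∪ ψ s '' Icc 0 1
  have hmem : ∀ k s, s ≠ k → z s ∈ closure (connectedComponentIn Kᶜ (y k)) := by
    intro k s hsk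
    obtain rfl | rfl : s = k + 1 ∨ s = k + 2 := by decide +revert
    · exact hy1 k
    · exact hy2 k
  have hinj : ∀ k l, y k ∈ connectedComponentIn Kᶜ (y l) → k = l := by
    intro k l hkl
    by_contra hne
    exact hyk k (connectedComponentIn_eq hkl ▸ hmem l k hne)
  refine ⟨y, hyK, fun k ↦ ?_, fun x hx ↦ ?_⟩
  · ext w
    constructor
    · rintro ⟨hw, s, rfl⟩
      exact ⟨s, fun hs ↦ hyk k (by rwa [mem_singleton_iff.1 hs] at hw), rfl⟩
    · rintro ⟨s, hs, rfl⟩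
      exact ⟨hmem k s hs, s, rfl⟩
  · by_contra! hall
    obtain ⟨i, j, hij, hmem⟩ := exists_mem_connectedComponentIn_of_four h.isLogTrivial_arc
      (fun s t hst ↦ h.inter_arc hst) (Fin.cons x y) (Fin.cases hx hyK)
    cases i using Fin.cases with
    | zero =>
      cases j using Fin.cases with
      | zero => exact hij rfl
      | succ j => exact hall j (connectedComponentIn_eq hmem)
    | succ i =>
      cases j using Fin.cases with
      | zero => exact hall i (connectedComponentIn_eq hmem).symm
      | succ j => exact hij (congrArg Fin.succ (hinj j i hmem).symm)

end IsThetaCurve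

theorem stmt_12 (z : Fin 3 → Plane) (hz : Function.Injective z)
    (z' z'' : Plane) (hzz : z' ≠ z'')
    (φ ψ : Fin 3 → ℝ → Plane)
    (hφcont : ∀ s, ContinuousOn (φ s) (Icc 0 1))
    (hφinj : ∀ s, InjOn (φ s) (Icc 0 1))
    (hψcont : ∀ s, ContinuousOn (ψ s) (Icc 0 1))
    (hψinj : ∀ s, InjOn (ψ s) (Icc 0 1))
    (hφ0 : ∀ s, φ s 0 = z s) (hφ1 : ∀ s, φ s 1 = z')
    (hψ0 : ∀ s, ψ s 0 = z s) (hψ1 : ∀ s, ψ s 1 = z'')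
    (hφdisj : ∀ s t, s ≠ t → φ s '' Ico 0 1 ∩ φ t '' Ico 0 1 = ∅)
    (hψdisj : ∀ s t, s ≠ t → ψ s '' Ico 0 1 ∩ ψ t '' Ico 0 1 = ∅)
    (hmeet : (⋃ s, φ s '' Icc 0 1) ∩ (⋃ s, ψ s '' Icc 0 1) = range z) :
    ∃ U : Fin 3 → Set Plane, Function.Injective U ∧
      (∀ j, ∃ x ∈ (⋃ s, φ s '' Icc 0 1 ∪ ψ s '' Icc 0 1)ᶜ,
        U j = connectedComponentIn (⋃ s, φ s '' Icc 0 1 ∪ ψ s '' Icc 0 1)ᶜ x) ∧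
      (∀ x ∈ (⋃ s, φ s '' Icc 0 1 ∪ ψ s '' Icc 0 1)ᶜ,
        ∃ j, connectedComponentIn (⋃ s, φ s '' Icc 0 1 ∪ ψ s '' Icc 0 1)ᶜ x = U j) ∧
      (∀ j, (closure (U j) ∩ range z).ncard = 2) := by
  let e : Plane ≃ₜ ℂ := Complex.orthonormalBasisOneI.repr.symm.toHomeomorph
  have him : ∀ (f : ℝ → Plane) (S : Set ℝ), (fun t ↦ e (f t)) '' S = e '' (f '' S) :=
    fun f S ↦ (image_image e f S).symm
  have hθ : IsThetaCurve (fun s ↦ e (z s)) (e z') (e z'') (fun s t ↦ e (φ s t))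
      (fun s t ↦ e (ψ s t)) := by
    refine ⟨e.injective.comp hz, e.injective.ne hzz,
      fun s ↦ e.continuous.comp_continuousOn (hφcont s), fun s ↦ e.injective.comp_injOn (hφinj s),
      fun s ↦ e.continuous.comp_continuousOn (hψcont s), fun s ↦ e.injective.comp_injOn (hψinj s),
      fun s ↦ congrArg e (hφ0 s), fun s ↦ congrArg e (hφ1 s), fun s ↦ congrArg e (hψ0 s),
      fun s ↦ congrArg e (hψ1 s), fun s t hst ↦ ?_, fun s t hst ↦ ?_, ?_⟩
    · simp only [him]
      rw [← image_inter e.injective, hφdisj s t hst, image_empty]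
    · simp only [him]
      rw [← image_inter e.injective, hψdisj s t hst, image_empty]
    · simp only [him]
      rw [← image_iUnion, ← image_iUnion, ← image_inter e.injective, hmeet, ← range_comp]
      rfl
  obtain ⟨y, hyK, hyc, hyall⟩ := hθ.exists_components
  simp only [him, ← image_union, ← image_iUnion, ← e.image_compl] at hyK hyc hyall
  set K := (⋃ s, φ s '' Icc 0 1 ∪ ψ s '' Icc 0 1)ᶜ
  have hyK' : ∀ k, e.symm (y k) ∈ K := fun k ↦ by
    obtain ⟨x, hx, hxy⟩ := hyK k
    rwa [← hxy, e.symm_apply_apply]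
  have hU : ∀ k, connectedComponentIn (e '' K) (y k) =
      e '' connectedComponentIn K (e.symm (y k)) := fun k ↦ by
    rw [e.image_connectedComponentIn (hyK' k), e.apply_symm_apply]
  have hcl : ∀ k, closure (connectedComponentIn K (e.symm (y k))) ∩ range z = z '' {k}ᶜ := by
    intro k
    apply e.injective.image_injective
    rw [image_inter e.injective, e.image_closure, ← hU, ← range_comp, image_image, ← hyc k]
    rfl
  refine ⟨fun k ↦ connectedComponentIn K (e.symm (y k)), fun k l hkl ↦ ?_,
    fun k ↦ ⟨_, hyK' k, rfl⟩, fun x hx ↦ ?_, fun k ↦ ?_⟩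
  · have := hcl k
    beta_reduce at hkl
    rw [hkl, hcl l] at this
    exact (singleton_injective (compl_injective (hz.image_injective this))).symm
  · obtain ⟨k, hk⟩ := hyall (e x) (mem_image_of_mem e hx)
    rw [hU, ← e.image_connectedComponentIn hx] at hk
    exact ⟨k, e.injective.image_injective hk⟩
  · rw [hcl, ncard_image_of_injective _ hz, ncard_compl]
    simp
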